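/- For ρ ∈ (0,1) and m ≥ 2, there exist measurable sets Ω_1, ..., Ω_m partitioning ℝ^{n+1} with γ_{n+1}(Ω_i) = a_i for prescribed a_i > 0 summing to 1, which maximize Σ_{i=1}^m ∫ 1_{Ω_i} T_ρ 1_{Ω_i} dγ_{n+1} among all such measurable partitions. -/

import Mathlib

open MeasureTheory Real

noncomputable def gaussianDensity (n : ℕ) (x : EuclideanSpace ℝ (Fin n)) : ℝ :=
  (2 * Real.pi) ^ (-(n : ℝ) / 2) * Real.exp (-‖x‖ ^ 2 / 2)

noncomputable def gaussianMeasure (n : ℕ) : Measure (EuclideanSpace ℝ (Fin n)) :=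
  volume.withDensity (fun x => ENNReal.ofReal (gaussianDensity n x))

/-- The Ornstein-Uhlenbeck operator `T_ρ`. -/
noncomputable def ouOp (n : ℕ) (ρ : ℝ) (f : EuclideanSpace ℝ (Fin n) → ℝ)
    (x : EuclideanSpace ℝ (Fin n)) : ℝ :=
  ∫ y, f (ρ • x + Real.sqrt (1 - ρ ^ 2) • y) ∂(gaussianMeasure n)


lemma gaussianDensity_nonneg (d : ℕ) (x : EuclideanSpace ℝ (Fin d)) : 0 ≤ gaussianDensity d x := by
  unfold gaussianDensity; positivity

lemma continuous_gaussianDensity (d : ℕ) : Continuous (gaussianDensity d) := by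
  unfold gaussianDensity; fun_prop

lemma integral_gaussianMeasure (d : ℕ) (f : EuclideanSpace ℝ (Fin d) → ℝ) :
    ∫ x, f x ∂(gaussianMeasure d) = ∫ x, gaussianDensity d x * f x := by
  unfold gaussianMeasure
  rw [integral_withDensity_eq_integral_toReal_smul]
  · simp [ENNReal.toReal_ofReal (gaussianDensity_nonneg d _)]
  · exact (continuous_gaussianDensity d).measurable.ennreal_ofReal
  · simp

/-- Gaussian integral with a linear term. -/
lemma integral_exp_neg_mul_sq_norm_add_inner (d : ℕ) {b : ℝ} (hb : 0 < b)
    (w : EuclideanSpace ℝ (Fin d)) :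
    ∫ v : EuclideanSpace ℝ (Fin d), Real.exp (-b * ‖v‖ ^ 2 + inner ℝ w v)
      = (Real.pi / b) ^ ((d : ℝ) / 2) * Real.exp (‖w‖ ^ 2 / (4 * b)) := by
  have h := GaussianFourier.integral_rexp_neg_mul_sq_norm (V := EuclideanSpace ℝ (Fin d)) hb
  rw [finrank_euclideanSpace_fin] at h
  rw [← h, ← integral_add_right_eq_self _ ((2 * b)⁻¹ • w), ← integral_mul_const]
  congr 1 with v
  simp only [← Real.exp_add, norm_add_sq_real, norm_smul, inner_smul_right, inner_add_right,
    real_inner_comm w v, real_inner_self_eq_norm_sq, mul_pow, Real.norm_eq_abs, sq_abs]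
  congr 1
  field_simp
  ring

lemma isProbabilityMeasure_gaussianMeasure (d : ℕ) : IsProbabilityMeasure (gaussianMeasure d) := by
  constructor
  have h := integral_exp_neg_mul_sq_norm_add_inner d (b := 1 / 2) (by norm_num) 0
  have hpos : (0 : ℝ) < (Real.pi / (1 / 2)) ^ ((d : ℝ) / 2) := by positivity
  have hone : ∫ x, gaussianDensity d x = 1 := by
    have h2 : ∀ x : EuclideanSpace ℝ (Fin d), gaussianDensity d x
        = (2 * Real.pi) ^ (-(d : ℝ) / 2) * Real.exp (-(1 / 2) * ‖x‖ ^ 2 + inner ℝ 0 x) := by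
      intro x
      rw [gaussianDensity, inner_zero_left]
      ring_nf
    simp_rw [h2]
    rw [integral_const_mul, h, neg_div, Real.rpow_neg (by positivity)]
    have : Real.pi / (1 / 2) = 2 * Real.pi := by ring
    rw [this] at hpos ⊢
    simp [hpos.ne']
  unfold gaussianMeasure
  rw [withDensity_apply _ MeasurableSet.univ, Measure.restrict_univ,
    ← ofReal_integral_eq_lintegral_ofReal _ (.of_forall (gaussianDensity_nonneg d)), hone]
  · simp
  · by_contra hc
    rw [integral_undef hc] at hone
    norm_num at hone

/-- The Mehler kernel: the density of the Ornstein-Uhlenbeck operator `T_r` with respect to the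
Gaussian measure. -/
noncomputable def mehlerKernel (d : ℕ) (r : ℝ) (x z : EuclideanSpace ℝ (Fin d)) : ℝ :=
  (1 - r ^ 2) ^ (-(d : ℝ) / 2) *
    Real.exp ((2 * r * inner ℝ x z - r ^ 2 * ‖x‖ ^ 2 - r ^ 2 * ‖z‖ ^ 2) / (2 * (1 - r ^ 2)))

lemma mehlerKernel_nonneg (d : ℕ) {r : ℝ} (hr : r ^ 2 < 1) (x z : EuclideanSpace ℝ (Fin d)) :
    0 ≤ mehlerKernel d r x z := by
  have : 0 < 1 - r ^ 2 := by linarith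
  unfold mehlerKernel; positivity

lemma mehlerKernel_comm (d : ℕ) (r : ℝ) (x z : EuclideanSpace ℝ (Fin d)) :
    mehlerKernel d r x z = mehlerKernel d r z x := by
  unfold mehlerKernel
  rw [real_inner_comm]
  congr 3
  ring

lemma continuous_mehlerKernel (d : ℕ) (r : ℝ) :
    Continuous (Function.uncurry (mehlerKernel d r)) := by
  unfold mehlerKernel Function.uncurry
  fun_prop

lemma mehlerKernel_le (d : ℕ) {r : ℝ} (hr : r ^ 2 < 1) (x z : EuclideanSpace ℝ (Fin d)) :
    mehlerKernel d r x z ≤ (1 - r ^ 2) ^ (-(d : ℝ) / 2) * Real.exp (‖x‖ ^ 2 / 2) := by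
  have h : 0 < 1 - r ^ 2 := by linarith
  unfold mehlerKernel
  refine mul_le_mul_of_nonneg_left (Real.exp_le_exp.2 ?_) (by positivity)
  rw [div_le_div_iff₀ (by positivity) (by positivity)]
  have := norm_sub_sq_real x (r • z)
  rw [inner_smul_right, norm_smul, mul_pow, Real.norm_eq_abs, sq_abs] at this
  nlinarith [sq_nonneg ‖x - r • z‖]

lemma integral_mehlerKernel (d : ℕ) {r : ℝ} (hr : r ^ 2 < 1) (x : EuclideanSpace ℝ (Fin d)) :
    ∫ z, mehlerKernel d r x z ∂(gaussianMeasure d) = 1 := by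
  have h : 0 < 1 - r ^ 2 := by linarith
  have key := integral_exp_neg_mul_sq_norm_add_inner d (b := 1 / (2 * (1 - r ^ 2)))
    (by positivity) ((r / (1 - r ^ 2)) • x)
  rw [integral_gaussianMeasure]
  have h2 : ∀ z, gaussianDensity d z * mehlerKernel d r x z
      = ((2 * Real.pi) ^ (-(d : ℝ) / 2) * (1 - r ^ 2) ^ (-(d : ℝ) / 2)
          * Real.exp (-(r ^ 2 * ‖x‖ ^ 2) / (2 * (1 - r ^ 2)))) *
        Real.exp (-(1 / (2 * (1 - r ^ 2))) * ‖z‖ ^ 2 + inner ℝ ((r / (1 - r ^ 2)) • x) z) := by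
    intro z
    rw [gaussianDensity, mehlerKernel, mul_mul_mul_comm, ← Real.exp_add, mul_assoc _ (Real.exp _),
      ← Real.exp_add, real_inner_smul_left]
    congr 2
    field_simp
    ring
  simp_rw [h2]
  rw [integral_const_mul, key, norm_smul, mul_pow, Real.norm_eq_abs, sq_abs,
    ← Real.mul_rpow (by positivity) h.le, mul_mul_mul_comm, ← Real.exp_add, neg_div,
    Real.rpow_neg (by positivity)]
  have e1 : Real.pi / (1 / (2 * (1 - r ^ 2))) = 2 * Real.pi * (1 - r ^ 2) := by field_simp
  have hp : (0 : ℝ) < (2 * Real.pi * (1 - r ^ 2)) ^ ((d : ℝ) / 2) := by positivity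
  rw [e1, inv_mul_cancel₀ hp.ne', one_mul, Real.exp_eq_one_iff]
  field_simp
  ring

lemma integral_mehlerKernel_mul_mehlerKernel (d : ℕ) {r : ℝ} (hr : r ^ 2 < 1)
    (x z : EuclideanSpace ℝ (Fin d)) :
    ∫ y, mehlerKernel d r x y * mehlerKernel d r y z ∂(gaussianMeasure d)
      = mehlerKernel d (r ^ 2) x z := by
  have h : 0 < 1 - r ^ 2 := by linarith
  have h' : 0 < 1 + r ^ 2 := by positivity
  have key := integral_exp_neg_mul_sq_norm_add_inner d (b := (1 + r ^ 2) / (2 * (1 - r ^ 2)))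
    (by positivity) ((r / (1 - r ^ 2)) • (x + z))
  rw [integral_gaussianMeasure]
  have h2 : ∀ y, gaussianDensity d y * (mehlerKernel d r x y * mehlerKernel d r y z)
      = ((2 * Real.pi) ^ (-(d : ℝ) / 2) * ((1 - r ^ 2) ^ (-(d : ℝ) / 2)
          * (1 - r ^ 2) ^ (-(d : ℝ) / 2))
          * Real.exp (-(r ^ 2 * (‖x‖ ^ 2 + ‖z‖ ^ 2)) / (2 * (1 - r ^ 2)))) *
        Real.exp (-((1 + r ^ 2) / (2 * (1 - r ^ 2))) * ‖y‖ ^ 2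
          + inner ℝ ((r / (1 - r ^ 2)) • (x + z)) y) := by
    intro y
    rw [gaussianDensity, mehlerKernel, mehlerKernel, mul_mul_mul_comm ((1 - r ^ 2) ^ _),
      mul_mul_mul_comm ((2 * Real.pi) ^ _), ← Real.exp_add, ← Real.exp_add,
      mul_assoc (_ * (_ * _)) (Real.exp _), ← Real.exp_add, real_inner_smul_left, inner_add_left,
      real_inner_comm y z, real_inner_comm y x]
    congr 2
    field_simp
    ring
  have e1 : Real.pi / ((1 + r ^ 2) / (2 * (1 - r ^ 2)))
      = 2 * Real.pi * (1 - r ^ 2) * (1 + r ^ 2)⁻¹ := by field_simp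
  have e2 : 1 - (r ^ 2) ^ 2 = (1 - r ^ 2) * (1 + r ^ 2) := by ring
  have hp1 : (0 : ℝ) < (2 * Real.pi) ^ ((d : ℝ) / 2) := by positivity
  have hp2 : (0 : ℝ) < (1 - r ^ 2) ^ ((d : ℝ) / 2) := by positivity
  have hp3 : (0 : ℝ) < (1 + r ^ 2) ^ ((d : ℝ) / 2) := by positivity
  simp_rw [h2]
  have e3 : (2 * Real.pi * (1 - r ^ 2) * (1 + r ^ 2)⁻¹) ^ ((d : ℝ) / 2)
      = (2 * Real.pi) ^ ((d : ℝ) / 2) * (1 - r ^ 2) ^ ((d : ℝ) / 2)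
        * ((1 + r ^ 2) ^ ((d : ℝ) / 2))⁻¹ := by
    rw [Real.mul_rpow (by positivity) (by positivity), Real.mul_rpow (by positivity) h.le,
      Real.inv_rpow h'.le]
  rw [integral_const_mul, key, mehlerKernel, e1, e2, e3, norm_smul, mul_pow, Real.norm_eq_abs,
    sq_abs, mul_mul_mul_comm, ← Real.exp_add, norm_add_sq_real, neg_div,
    Real.rpow_neg (by positivity), Real.rpow_neg h.le, Real.rpow_neg (by positivity),
    Real.mul_rpow h.le h'.le]
  congr 1
  · field_simp
  · congr 1
    field_simp
    ring

lemma ouOp_eq_integral_mehlerKernel (d : ℕ) {ρ : ℝ} (hρ : ρ ^ 2 < 1)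
    (f : EuclideanSpace ℝ (Fin d) → ℝ) (x : EuclideanSpace ℝ (Fin d)) :
    ouOp d ρ f x = ∫ z, f z * mehlerKernel d ρ x z ∂(gaussianMeasure d) := by
  have h : 0 < 1 - ρ ^ 2 := by linarith
  set σ := Real.sqrt (1 - ρ ^ 2) with hσ
  have hs : 0 < σ := Real.sqrt_pos.2 h
  have hs2 : σ ^ 2 = 1 - ρ ^ 2 := Real.sq_sqrt h.le
  rw [ouOp, integral_gaussianMeasure, integral_gaussianMeasure, ← hσ]
  have h1 := Measure.integral_comp_smul (volume : Measure (EuclideanSpace ℝ (Fin d)))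
    (fun z => gaussianDensity d (σ⁻¹ • z) * f (ρ • x + z)) σ
  simp only [smul_smul, inv_mul_cancel₀ hs.ne', one_smul] at h1
  rw [h1, ← integral_sub_right_eq_self _ (ρ • x), finrank_euclideanSpace_fin, smul_eq_mul,
    ← integral_const_mul]
  congr 1 with z
  rw [add_sub_cancel, abs_of_nonneg (by positivity), gaussianDensity, gaussianDensity,
    mehlerKernel, norm_smul, mul_pow, norm_sub_sq_real, real_inner_smul_right, norm_smul, mul_pow,
    real_inner_comm x z]
  have e3 : (1 - ρ ^ 2) ^ (-(d : ℝ) / 2) = (σ ^ d)⁻¹ := by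
    rw [← hs2, ← Real.rpow_natCast, ← Real.rpow_mul hs.le, ← Real.rpow_natCast,
      ← Real.rpow_neg hs.le]
    congr 1
    push_cast
    ring
  rw [e3]
  have e4 : Real.exp (-(‖σ⁻¹‖ ^ 2 * (‖z‖ ^ 2 - 2 * (ρ * inner ℝ x z) + ‖ρ‖ ^ 2 * ‖x‖ ^ 2)) / 2)
      = Real.exp (-‖z‖ ^ 2 / 2) *
        Real.exp ((2 * ρ * inner ℝ x z - ρ ^ 2 * ‖x‖ ^ 2 - ρ ^ 2 * ‖z‖ ^ 2)
          / (2 * (1 - ρ ^ 2))) := by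
    rw [← Real.exp_add, Real.norm_eq_abs, Real.norm_eq_abs, sq_abs, sq_abs, inv_pow, hs2]
    congr 1
    field_simp
    ring
  rw [e4]
  ring

section NoiseStability

variable {E : Type*} [MeasurableSpace E]

/-- A nonnegative jointly measurable function `k` whose sections `k y` are bounded probability
densities with respect to `μ`. -/
structure IsMarkovDensity (μ : Measure E) (k : E → E → ℝ) : Prop where
  measurable : Measurable (Function.uncurry k)
  nonneg : ∀ y z, 0 ≤ k y z
  bounded : ∀ y, ∃ C, ∀ z, k y z ≤ C
  integral_eq_one : ∀ y, ∫ z, k y z ∂μ = 1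

namespace IsMarkovDensity

variable {μ : Measure E} {k : E → E → ℝ}

lemma integrable (hk : IsMarkovDensity μ k) (y : E) : Integrable (k y) μ := by
  by_contra h
  have := hk.integral_eq_one y
  rw [integral_undef h] at this
  norm_num at this

lemma measurable_section (hk : IsMarkovDensity μ k) (y : E) : Measurable (k y) :=
  hk.measurable.comp measurable_prodMk_left

lemma memLp [IsFiniteMeasure μ] (hk : IsMarkovDensity μ k) (y : E) : MemLp (k y) 2 μ := by
  obtain ⟨C, hC⟩ := hk.bounded y
  refine MemLp.of_bound (hk.measurable_section y).aestronglyMeasurable C (.of_forall fun z => ?_)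
  rw [Real.norm_of_nonneg (hk.nonneg y z)]
  exact hC z

/-- The section `k y` as an element of `L²`. -/
noncomputable def sectionLp [IsFiniteMeasure μ] (hk : IsMarkovDensity μ k) (y : E) : Lp ℝ 2 μ :=
  (hk.memLp y).toLp

end IsMarkovDensity

section Representation

variable {μ : Measure E}

/-- The `L²` function representing a weak-* functional on `L²`. -/
noncomputable def rieszRep (φ : WeakDual ℝ (Lp ℝ 2 μ)) : Lp ℝ 2 μ :=
  (InnerProductSpace.toDual ℝ (Lp ℝ 2 μ)).symm (WeakDual.toStrongDual φ)

/-- The weak-* functional on `L²` given by integration against `f`. -/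
noncomputable def ofLp (f : Lp ℝ 2 μ) : WeakDual ℝ (Lp ℝ 2 μ) :=
  StrongDual.toWeakDual (InnerProductSpace.toDual ℝ (Lp ℝ 2 μ) f)

lemma rieszRep_ofLp (f : Lp ℝ 2 μ) : rieszRep (ofLp f) = f := by
  simp [rieszRep, ofLp]

lemma ofLp_rieszRep (φ : WeakDual ℝ (Lp ℝ 2 μ)) : ofLp (rieszRep φ) = φ := by
  simp [rieszRep, ofLp]

lemma ofLp_apply (f g : Lp ℝ 2 μ) : ofLp f g = inner ℝ f g := by
  simp [ofLp]

lemma apply_eq_integral (φ : WeakDual ℝ (Lp ℝ 2 μ)) (g : Lp ℝ 2 μ) :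
    φ g = ∫ x, rieszRep φ x * g x ∂μ := by
  conv_lhs => rw [← ofLp_rieszRep φ, ofLp_apply, L2.inner_def]
  simp [mul_comm]

/-- The indicator function of a measurable set as an element of `L²`. -/
noncomputable def indL [IsFiniteMeasure μ] {s : Set E} (hs : MeasurableSet s) : Lp ℝ 2 μ :=
  indicatorConstLp 2 hs (measure_ne_top μ s) 1

lemma indL_coe [IsFiniteMeasure μ] {s : Set E} (hs : MeasurableSet s) :
    ∀ᵐ x ∂μ, (indL hs : Lp ℝ 2 μ) x = s.indicator (fun _ => (1 : ℝ)) x :=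
  indicatorConstLp_coeFn

lemma apply_indL [IsFiniteMeasure μ] (φ : WeakDual ℝ (Lp ℝ 2 μ)) {s : Set E}
    (hs : MeasurableSet s) : φ (indL hs) = ∫ x in s, rieszRep φ x ∂μ := by
  conv_lhs => rw [← ofLp_rieszRep φ, ofLp_apply, real_inner_comm]
  exact L2.inner_indicatorConstLp_one hs _ _

lemma integrable_rieszRep [IsFiniteMeasure μ] (φ : WeakDual ℝ (Lp ℝ 2 μ)) :
    Integrable (rieszRep φ) μ :=
  (Lp.memLp (rieszRep φ)).integrable (by norm_num)

lemma ofLp_indL_apply_indL [IsFiniteMeasure μ] {s t : Set E} (hs : MeasurableSet s)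
    (ht : MeasurableSet t) : (ofLp (indL hs : Lp ℝ 2 μ)) (indL ht) = μ.real (s ∩ t) := by
  rw [apply_indL, rieszRep_ofLp, setIntegral_congr_ae ht ((indL_coe hs).mono fun x hx _ => hx),
    integral_indicator_const _ hs]
  simp [measureReal_restrict_apply hs]

lemma apply_sectionLp [IsFiniteMeasure μ] {k : E → E → ℝ} (hk : IsMarkovDensity μ k)
    (φ : WeakDual ℝ (Lp ℝ 2 μ)) (y : E) :
    φ (hk.sectionLp y) = ∫ z, rieszRep φ z * k y z ∂μ := by
  rw [apply_eq_integral]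
  refine integral_congr_ae ((hk.memLp y).coeFn_toLp.mono fun z hz => ?_)
  simp only [IsMarkovDensity.sectionLp, hz]

lemma measurable_apply_sectionLp [IsFiniteMeasure μ] {k : E → E → ℝ} (hk : IsMarkovDensity μ k)
    (φ : WeakDual ℝ (Lp ℝ 2 μ)) : StronglyMeasurable fun y => φ (hk.sectionLp y) := by
  simp_rw [apply_sectionLp hk]
  refine StronglyMeasurable.integral_prod_right (f := fun y z => rieszRep φ z * k y z) ?_
  exact (((Lp.stronglyMeasurable (rieszRep φ)).measurable.comp measurable_snd).mul
    hk.measurable).stronglyMeasurable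

lemma ofLp_indL_sectionLp [IsFiniteMeasure μ] {k : E → E → ℝ} (hk : IsMarkovDensity μ k)
    {s : Set E} (hs : MeasurableSet s) (y : E) :
    ofLp (indL hs : Lp ℝ 2 μ) (hk.sectionLp y) = ∫ z in s, k y z ∂μ := by
  rw [apply_sectionLp, rieszRep_ofLp, ← integral_indicator hs]
  refine integral_congr_ae ((indL_coe hs).mono fun z hz => ?_)
  simp only [hz]
  by_cases h : z ∈ s <;> simp [h]

end Representation

section UnitInterval

variable (μ : Measure E) [IsProbabilityMeasure μ]

/-- The functionals represented by functions with values in `[0, 1]`. -/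
def unitFunctionals : Set (WeakDual ℝ (Lp ℝ 2 μ)) :=
  {φ | ∀ (s : Set E) (hs : MeasurableSet s), 0 ≤ φ (indL hs) ∧ φ (indL hs) ≤ μ.real s}

variable {μ}

lemma rieszRep_nonneg {φ : WeakDual ℝ (Lp ℝ 2 μ)}
    (h : ∀ (s : Set E) (hs : MeasurableSet s), 0 ≤ φ (indL hs)) : ∀ᵐ x ∂μ, 0 ≤ rieszRep φ x :=
  ae_nonneg_of_forall_setIntegral_nonneg (integrable_rieszRep φ)
    fun s hs _ => by rw [← apply_indL φ hs]; exact h s hs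

lemma rieszRep_le_one {φ : WeakDual ℝ (Lp ℝ 2 μ)}
    (h : ∀ (s : Set E) (hs : MeasurableSet s), φ (indL hs) ≤ μ.real s) :
    ∀ᵐ x ∂μ, rieszRep φ x ≤ 1 := by
  have := ae_nonneg_of_forall_setIntegral_nonneg
    (f := fun x => 1 - rieszRep φ x) (μ := μ) ((integrable_const _).sub (integrable_rieszRep φ))
    fun s hs _ => by
      rw [integral_sub (integrable_const _) (integrable_rieszRep φ).integrableOn,
        ← apply_indL φ hs]
      simpa using h s hs
  filter_upwards [this] with x hx
  simpa using hx

lemma isClosed_unitFunctionals : IsClosed (unitFunctionals μ) := by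
  have : unitFunctionals μ = ⋂ (s : Set E) (hs : MeasurableSet s),
      {φ : WeakDual ℝ (Lp ℝ 2 μ) | φ (indL hs) ∈ Set.Icc 0 (μ.real s)} := by
    ext φ; simp [unitFunctionals]
  rw [this]
  exact isClosed_iInter fun s => isClosed_iInter fun hs =>
    isClosed_Icc.preimage (WeakDual.eval_continuous _)

lemma isCompact_unitFunctionals : IsCompact (unitFunctionals μ) := by
  refine IsCompact.of_isClosed_subset (WeakDual.isCompact_closedBall
    (0 : StrongDual ℝ (Lp ℝ 2 μ)) (measureUnivNNReal μ ^ (ENNReal.toReal 2)⁻¹ * 1))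
    isClosed_unitFunctionals fun φ hφ => ?_
  have h : ‖rieszRep φ‖ ≤ measureUnivNNReal μ ^ (ENNReal.toReal 2)⁻¹ * 1 := by
    refine Lp.norm_le_of_ae_bound zero_le_one ?_
    filter_upwards [rieszRep_nonneg fun s hs => (hφ s hs).1,
      rieszRep_le_one fun s hs => (hφ s hs).2] with x h0 h1
    rwa [Real.norm_of_nonneg h0]
  rw [rieszRep, LinearIsometryEquiv.norm_map] at h
  simpa using h

variable {k : E → E → ℝ}

lemma apply_sectionLp_mem_Icc (hk : IsMarkovDensity μ k) {φ : WeakDual ℝ (Lp ℝ 2 μ)}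
    (hφ : φ ∈ unitFunctionals μ) (y : E) : φ (hk.sectionLp y) ∈ Set.Icc 0 1 := by
  rw [apply_sectionLp]
  have h0 := rieszRep_nonneg fun s hs => (hφ s hs).1
  constructor
  · refine integral_nonneg_of_ae (h0.mono fun z hz => mul_nonneg hz (hk.nonneg y z))
  · rw [← hk.integral_eq_one y]
    refine integral_mono_of_nonneg (h0.mono fun z hz => mul_nonneg hz (hk.nonneg y z))
      (hk.integrable y) ?_
    filter_upwards [rieszRep_le_one fun s hs => (hφ s hs).2] with z hz
    exact mul_le_of_le_one_left (hk.nonneg y z) hz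

/-- The squared `L²` norm of the image of a functional under the Markov operator with density
`k`. -/
noncomputable def energy (hk : IsMarkovDensity μ k) (φ : WeakDual ℝ (Lp ℝ 2 μ)) : ℝ :=
  ∫ y, φ (hk.sectionLp y) ^ 2 ∂μ

lemma sq_apply_sectionLp_le (hk : IsMarkovDensity μ k) {φ : WeakDual ℝ (Lp ℝ 2 μ)}
    (hφ : φ ∈ unitFunctionals μ) (y : E) : ‖φ (hk.sectionLp y) ^ 2‖ ≤ 1 := by
  have h := apply_sectionLp_mem_Icc hk hφ y
  rw [Real.norm_of_nonneg (sq_nonneg _)]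
  exact pow_le_one₀ h.1 h.2

lemma integrable_sq_apply_sectionLp (hk : IsMarkovDensity μ k) {φ : WeakDual ℝ (Lp ℝ 2 μ)}
    (hφ : φ ∈ unitFunctionals μ) : Integrable (fun y => φ (hk.sectionLp y) ^ 2) μ :=
  Integrable.of_bound ((measurable_apply_sectionLp hk φ).pow 2).aestronglyMeasurable 1
    (.of_forall (sq_apply_sectionLp_le hk hφ))

lemma continuousOn_energy [MeasurableSpace.CountablyGenerated E] (hk : IsMarkovDensity μ k) :
    ContinuousOn (energy hk) (unitFunctionals μ) := by
  have : Fact ((2 : ENNReal) ≠ ⊤) := ⟨by simp⟩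
  have : TopologicalSpace.MetrizableSpace (unitFunctionals μ) :=
    WeakDual.metrizable_of_isCompact ℝ _ _ isCompact_unitFunctionals
  rw [continuousOn_iff_continuous_domRestrict]
  refine continuous_of_dominated (bound := fun _ => 1) (F := fun φ : unitFunctionals μ => fun y =>
    φ.1 (hk.sectionLp y) ^ 2) (fun φ => ?_) (fun φ => .of_forall ?_) (integrable_const _)
    (.of_forall fun y => ?_)
  · exact ((measurable_apply_sectionLp hk φ.1).pow 2).aestronglyMeasurable
  · exact sq_apply_sectionLp_le hk φ.2
  · exact ((WeakDual.eval_continuous _).comp continuous_subtype_val).pow 2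

lemma energy_combo_le (hk : IsMarkovDensity μ k) {φ ψ : WeakDual ℝ (Lp ℝ 2 μ)}
    (hφ : φ ∈ unitFunctionals μ) (hψ : ψ ∈ unitFunctionals μ) {a b : ℝ} (ha : 0 ≤ a) (hb : 0 ≤ b)
    (hab : a + b = 1) :
    energy hk (a • φ + b • ψ) ≤ a * energy hk φ + b * energy hk ψ := by
  have h1 := (integrable_sq_apply_sectionLp hk hφ).const_mul a
  have h2 := (integrable_sq_apply_sectionLp hk hψ).const_mul b
  unfold energy
  rw [← integral_const_mul, ← integral_const_mul, ← integral_add h1 h2]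
  refine integral_mono_of_nonneg (.of_forall fun y => sq_nonneg _) (h1.add h2)
    (.of_forall fun y => ?_)
  have := (convexOn_pow (𝕜 := ℝ) 2).2 (apply_sectionLp_mem_Icc hk hφ y).1
    (apply_sectionLp_mem_Icc hk hψ y).1 ha hb hab
  exact this

end UnitInterval

section Partitions

variable {μ : Measure E} [IsProbabilityMeasure μ] {k : E → E → ℝ}
  {ι : Type*} [Fintype ι] {a : ι → ℝ}

/-- The weak-* model of measurable functions into the simplex with prescribed integrals `a i`. -/
def simplexFunctionals (μ : Measure E) [IsProbabilityMeasure μ] (a : ι → ℝ) :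
    Set (ι → WeakDual ℝ (Lp ℝ 2 μ)) :=
  {φ | (∀ i (s : Set E) (hs : MeasurableSet s), 0 ≤ φ i (indL hs)) ∧
    (∀ (s : Set E) (hs : MeasurableSet s), ∑ i, φ i (indL hs) = μ.real s) ∧
    ∀ i, φ i (indL MeasurableSet.univ) = a i}

lemma simplexFunctionals_subset_pi :
    simplexFunctionals μ a ⊆ Set.univ.pi fun _ => unitFunctionals μ := by
  intro φ hφ i _ s hs
  refine ⟨hφ.1 i s hs, ?_⟩
  rw [← hφ.2.1 s hs]
  exact Finset.single_le_sum (f := fun i => φ i (indL hs)) (fun j _ => hφ.1 j s hs)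
    (Finset.mem_univ i)

lemma isClosed_simplexFunctionals : IsClosed (simplexFunctionals μ a) := by
  have hc : ∀ i (g : Lp ℝ 2 μ), Continuous fun φ : ι → WeakDual ℝ (Lp ℝ 2 μ) => φ i g :=
    fun i g => (WeakDual.eval_continuous g).comp (continuous_apply i)
  have : simplexFunctionals μ a =
      (⋂ (i) (s : Set E) (hs : MeasurableSet s),
        {φ : ι → WeakDual ℝ (Lp ℝ 2 μ) | 0 ≤ φ i (indL hs)}) ∩
      ((⋂ (s : Set E) (hs : MeasurableSet s),
        {φ : ι → WeakDual ℝ (Lp ℝ 2 μ) | ∑ i, φ i (indL hs) = μ.real s}) ∩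
      ⋂ i, {φ : ι → WeakDual ℝ (Lp ℝ 2 μ) | φ i (indL MeasurableSet.univ) = a i}) := by
    ext φ; simp [simplexFunctionals]
  rw [this]
  refine .inter ?_ (.inter ?_ ?_)
  · exact isClosed_iInter fun i => isClosed_iInter fun s => isClosed_iInter fun hs =>
      isClosed_le continuous_const (hc i _)
  · exact isClosed_iInter fun s => isClosed_iInter fun hs =>
      isClosed_eq (continuous_finsetSum _ fun i _ => hc i _) continuous_const
  · exact isClosed_iInter fun i => isClosed_eq (hc i _) continuous_const

lemma isCompact_simplexFunctionals : IsCompact (simplexFunctionals μ a) :=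
  (isCompact_univ_pi fun _ => isCompact_unitFunctionals).of_isClosed_subset
    isClosed_simplexFunctionals simplexFunctionals_subset_pi

lemma simplexFunctionals_nonempty (ha : ∀ i, 0 ≤ a i) (hsum : ∑ i, a i = 1) :
    (simplexFunctionals μ a).Nonempty := by
  have h : ∀ i (s : Set E) (hs : MeasurableSet s),
      (a i • ofLp (indL MeasurableSet.univ : Lp ℝ 2 μ)) (indL hs) = a i * μ.real s := by
    intro i s hs
    change a i * (ofLp (indL MeasurableSet.univ : Lp ℝ 2 μ)) (indL hs) = _
    rw [ofLp_indL_apply_indL, Set.univ_inter]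
  refine ⟨fun i => a i • ofLp (indL MeasurableSet.univ), fun i s hs => ?_, fun s hs => ?_,
    fun i => ?_⟩
  · rw [h]
    exact mul_nonneg (ha i) measureReal_nonneg
  · simp_rw [h]
    rw [← Finset.sum_mul, hsum, one_mul]
  · rw [h]
    simp

lemma ofLp_indL_mem_simplexFunctionals {Θ : ι → Set E} (hΘ : ∀ i, MeasurableSet (Θ i))
    (hd : Pairwise fun i j => Θ i ∩ Θ j = ∅) (hu : ⋃ i, Θ i = Set.univ)
    (hm : ∀ i, μ.real (Θ i) = a i) :
    (fun i => ofLp (indL (hΘ i) : Lp ℝ 2 μ)) ∈ simplexFunctionals μ a := by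
  refine ⟨fun i s hs => ?_, fun s hs => ?_, fun i => ?_⟩
  · rw [ofLp_indL_apply_indL]
    exact measureReal_nonneg
  · simp_rw [ofLp_indL_apply_indL]
    rw [← measureReal_iUnion_fintype (fun i j hij => ?_) fun i => (hΘ i).inter hs,
      ← Set.iUnion_inter, hu, Set.univ_inter]
    exact ((Set.disjoint_iff_inter_eq_empty.2 (hd hij)).mono Set.inter_subset_left
      Set.inter_subset_left)
  · rw [ofLp_indL_apply_indL, Set.inter_univ, hm]

/-- The sum of the energies of the components. -/
noncomputable def totalEnergy (hk : IsMarkovDensity μ k) (φ : ι → WeakDual ℝ (Lp ℝ 2 μ)) : ℝ :=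
  ∑ i, energy hk (φ i)

lemma continuousOn_totalEnergy [MeasurableSpace.CountablyGenerated E]
    (hk : IsMarkovDensity μ k) : ContinuousOn (totalEnergy hk) (simplexFunctionals μ a) :=
  continuousOn_finsetSum _ fun i _ => (continuousOn_energy hk).comp
    (continuous_apply i).continuousOn fun _ hφ => simplexFunctionals_subset_pi hφ i trivial

/-- The convex function `totalEnergy` attains its maximum at an extreme point. -/
lemma exists_mem_extremePoints_isMaxOn [MeasurableSpace.CountablyGenerated E]
    (hk : IsMarkovDensity μ k) (ha : ∀ i, 0 ≤ a i) (hsum : ∑ i, a i = 1) :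
    ∃ φ ∈ (simplexFunctionals μ a).extremePoints ℝ,
      IsMaxOn (totalEnergy hk) (simplexFunctionals μ a) φ := by
  obtain ⟨φ₀, hφ₀, hmax⟩ := isCompact_simplexFunctionals.exists_isMaxOn
    (simplexFunctionals_nonempty (μ := μ) ha hsum) (continuousOn_totalEnergy hk)
  set K := simplexFunctionals μ a with hK
  set M := K ∩ totalEnergy hk ⁻¹' Set.Ici (totalEnergy hk φ₀) with hM
  have hMc : IsCompact M := isCompact_simplexFunctionals.of_isClosed_subset
    ((continuousOn_totalEnergy hk).preimage_isClosed_of_isClosed isClosed_simplexFunctionals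
      isClosed_Ici) Set.inter_subset_left
  have hMe : IsExtreme ℝ K M := by
    refine ⟨Set.inter_subset_left, fun x hx y hy z hz hzxy => ⟨hx, ?_⟩⟩
    obtain ⟨s, t, hs, ht, hst, rfl⟩ := hzxy
    have h1 : totalEnergy hk (s • x + t • y)
        ≤ s * totalEnergy hk x + t * totalEnergy hk y := by
      unfold totalEnergy
      rw [Finset.mul_sum, Finset.mul_sum, ← Finset.sum_add_distrib]
      exact Finset.sum_le_sum fun i _ => energy_combo_le hk
        (simplexFunctionals_subset_pi hx i trivial) (simplexFunctionals_subset_pi hy i trivial)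
        hs.le ht.le hst
    have h2 : totalEnergy hk φ₀ ≤ totalEnergy hk (s • x + t • y) := hz.2
    have h3 : totalEnergy hk y ≤ totalEnergy hk φ₀ := hmax hy
    have h4 : s * totalEnergy hk φ₀ ≤ s * totalEnergy hk x := by
      have : t = 1 - s := by linarith
      subst this
      nlinarith
    exact le_of_mul_le_mul_left h4 hs
  have : LocallyConvexSpace ℝ (WeakDual ℝ (Lp ℝ 2 μ)) :=
    inferInstanceAs (LocallyConvexSpace ℝ (WeakBilin _))
  have hφ₀M : φ₀ ∈ M := ⟨hφ₀, le_refl (totalEnergy hk φ₀)⟩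
  obtain ⟨φ, hφ⟩ := hMc.extremePoints_nonempty ⟨φ₀, hφ₀M⟩
  exact ⟨φ, hMe.extremePoints_subset_extremePoints hφ,
    fun ψ hψ => le_trans (b := totalEnergy hk φ₀) (hmax hψ) hφ.1.2⟩

/-- For an atomless measure, a set of positive measure contains two disjoint measurable subsets of
positive measure. -/
lemma exists_disjoint_subsets_pos [TopologicalSpace E] [SecondCountableTopology E] [T2Space E]
    [OpensMeasurableSpace E] [NullSingletonClass μ] {A : Set E} (hA : MeasurableSet A)
    (hpos : μ A ≠ 0) :
    ∃ B C : Set E, MeasurableSet B ∧ MeasurableSet C ∧ B ⊆ A ∧ C ⊆ A ∧ Disjoint B C ∧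
      0 < μ.real B ∧ 0 < μ.real C := by
  obtain ⟨x, hxA, hx⟩ := exists_mem_forall_mem_nhdsWithin_pos_measure hpos
  have hpos' : μ (A \ {x}) ≠ 0 := by
    rwa [measure_sdiff_null (measure_singleton x)]
  obtain ⟨y, hyA, hy⟩ := exists_mem_forall_mem_nhdsWithin_pos_measure hpos'
  obtain ⟨U, V, hU, hV, hxU, hyV, hUV⟩ := t2_separation (Ne.symm hyA.2 : x ≠ y)
  have hy' := hy (V ∩ (A \ {x})) (inter_mem_nhdsWithin _ (hV.mem_nhds hyV) |> fun h => by
    rwa [Set.inter_comm] at h)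
  have hx' := hx (U ∩ A) (inter_mem_nhdsWithin _ (hU.mem_nhds hxU) |> fun h => by
    rwa [Set.inter_comm] at h)
  refine ⟨U ∩ A, V ∩ A, hU.measurableSet.inter hA, hV.measurableSet.inter hA,
    Set.inter_subset_right, Set.inter_subset_right,
    hUV.mono Set.inter_subset_left Set.inter_subset_left, ?_, ?_⟩
  · exact ENNReal.toReal_pos hx'.ne' (measure_ne_top _ _)
  · refine ENNReal.toReal_pos (hy'.trans_le (measure_mono ?_)).ne' (measure_ne_top _ _)
    exact Set.inter_subset_inter_right _ Set.sdiff_subset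

open Classical in
lemma add_single_sub_single_mem_simplexFunctionals {φ : ι → WeakDual ℝ (Lp ℝ 2 μ)}
    (hφ : φ ∈ simplexFunctionals μ a) {i j : ι} {η : WeakDual ℝ (Lp ℝ 2 μ)}
    (hi : ∀ (s : Set E) (hs : MeasurableSet s), |η (indL hs)| ≤ φ i (indL hs))
    (hj : ∀ (s : Set E) (hs : MeasurableSet s), |η (indL hs)| ≤ φ j (indL hs))
    (hij : i ≠ j) (h0 : η (indL MeasurableSet.univ) = 0) :
    φ + Pi.single i η - Pi.single j η ∈ simplexFunctionals μ a := by
  have key : ∀ l (g : Lp ℝ 2 μ), (φ + Pi.single i η - Pi.single j η : ι → WeakDual ℝ (Lp ℝ 2 μ)) l g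
      = φ l g + (if l = i then η g else 0) - (if l = j then η g else 0) := by
    intro l g
    change φ l g + (Pi.single i η : ι → WeakDual ℝ (Lp ℝ 2 μ)) l g
      - (Pi.single j η : ι → WeakDual ℝ (Lp ℝ 2 μ)) l g = _
    rw [Pi.single_apply, Pi.single_apply]
    split_ifs <;> rfl
  refine ⟨fun l s hs => ?_, fun s hs => ?_, fun l => ?_⟩
  · rw [key]
    by_cases hli : l = i
    · subst hli
      have := neg_le_of_abs_le (hi s hs)
      simp [hij]
      linarith
    · by_cases hlj : l = j
      · subst hlj
        have := le_of_abs_le (hj s hs)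
        simp [hli]
        linarith
      · simpa [hli, hlj] using hφ.1 l s hs
  · simp_rw [key]
    rw [Finset.sum_sub_distrib, Finset.sum_add_distrib, hφ.2.1 s hs]
    simp
  · rw [key, h0, hφ.2.2 l]
    simp

lemma mul_measureReal_inter_le_apply_indL {φ : WeakDual ℝ (Lp ℝ 2 μ)}
    (hφ : ∀ᵐ x ∂μ, 0 ≤ rieszRep φ x) {ε : ℝ} {A s : Set E} (hA : MeasurableSet A)
    (hs : MeasurableSet s) (hεA : ∀ x ∈ A, ε ≤ rieszRep φ x) :
    ε * μ.real (A ∩ s) ≤ φ (indL hs) := by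
  rw [apply_indL]
  have hint := integrable_rieszRep φ
  calc ε * μ.real (A ∩ s) = ∫ _ in A ∩ s, ε ∂μ := by simp [mul_comm]
    _ ≤ ∫ x in A ∩ s, rieszRep φ x ∂μ :=
      setIntegral_mono_on (integrable_const _) hint.integrableOn (hA.inter hs)
        fun x hx => hεA x hx.1
    _ ≤ ∫ x in s, rieszRep φ x ∂μ :=
      setIntegral_mono_set hint.integrableOn (ae_restrict_of_ae hφ)
        (.of_forall Set.inter_subset_right)

/-- Two components of an extreme point are never simultaneously nonzero. -/
lemma ae_eq_zero_or_eq_zero_of_mem_extremePoints [TopologicalSpace E]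
    [SecondCountableTopology E] [T2Space E] [OpensMeasurableSpace E] [NullSingletonClass μ]
    {φ : ι → WeakDual ℝ (Lp ℝ 2 μ)} (hφ : φ ∈ (simplexFunctionals μ a).extremePoints ℝ)
    {i j : ι} (hij : i ≠ j) :
    ∀ᵐ x ∂μ, rieszRep (φ i) x = 0 ∨ rieszRep (φ j) x = 0 := by
  classical
  have hnn : ∀ l, ∀ᵐ x ∂μ, 0 ≤ rieszRep (φ l) x := fun l => rieszRep_nonneg (hφ.1.1 l)
  have hmeas : ∀ l, Measurable (rieszRep (φ l)) := fun l => (Lp.stronglyMeasurable _).measurable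
  suffices h : ∀ n : ℕ, ∀ᵐ x ∂μ,
      ¬ (1 / ((n : ℝ) + 1) ≤ rieszRep (φ i) x ∧ 1 / ((n : ℝ) + 1) ≤ rieszRep (φ j) x) by
    filter_upwards [hnn i, hnn j, ae_all_iff.2 h] with x hi hj hx
    by_contra! hc
    obtain ⟨n, hn⟩ := exists_nat_one_div_lt
      (lt_min (lt_of_le_of_ne hi hc.1.symm) (lt_of_le_of_ne hj hc.2.symm))
    exact hx n ⟨(hn.trans_le (min_le_left _ _)).le, (hn.trans_le (min_le_right _ _)).le⟩
  intro n
  set ε : ℝ := 1 / ((n : ℝ) + 1) with hε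
  have hε0 : 0 < ε := by positivity
  set A : Set E := {x | ε ≤ rieszRep (φ i) x ∧ ε ≤ rieszRep (φ j) x} with hAdef
  have hA : MeasurableSet A :=
    (measurableSet_le measurable_const (hmeas i)).inter
      (measurableSet_le measurable_const (hmeas j))
  by_contra hc
  have hA0 : μ A ≠ 0 := fun h => hc (by
    rw [ae_iff]
    simpa only [not_not] using h)
  obtain ⟨B, C, hB, hC, hBA, hCA, hBC, hB0, hC0⟩ := exists_disjoint_subsets_pos hA hA0
  set η : WeakDual ℝ (Lp ℝ 2 μ) :=
    (ε * μ.real C) • ofLp (indL hB) - (ε * μ.real B) • ofLp (indL hC) with hη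
  have hη_apply : ∀ (s : Set E) (hs : MeasurableSet s), η (indL hs)
      = ε * (μ.real C * μ.real (B ∩ s) - μ.real B * μ.real (C ∩ s)) := by
    intro s hs
    change (ε * μ.real C) * (ofLp (indL hB : Lp ℝ 2 μ)) (indL hs)
      - (ε * μ.real B) * (ofLp (indL hC : Lp ℝ 2 μ)) (indL hs) = _
    rw [ofLp_indL_apply_indL, ofLp_indL_apply_indL]
    ring
  have hbound : ∀ (s : Set E) (hs : MeasurableSet s), |η (indL hs)| ≤ ε * μ.real (A ∩ s) := by
    intro s hs
    have hB1 : μ.real (B ∩ s) ≤ μ.real (A ∩ s) :=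
      measureReal_mono (Set.inter_subset_inter_left _ hBA)
    have hC1 : μ.real (C ∩ s) ≤ μ.real (A ∩ s) :=
      measureReal_mono (Set.inter_subset_inter_left _ hCA)
    have hB2 : μ.real C * μ.real (B ∩ s) ≤ μ.real (A ∩ s) :=
      (mul_le_of_le_one_left measureReal_nonneg measureReal_le_one).trans hB1
    have hC2 : μ.real B * μ.real (C ∩ s) ≤ μ.real (A ∩ s) :=
      (mul_le_of_le_one_left measureReal_nonneg measureReal_le_one).trans hC1
    have hB3 : 0 ≤ μ.real C * μ.real (B ∩ s) := by positivity
    have hC3 : 0 ≤ μ.real B * μ.real (C ∩ s) := by positivity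
    rw [hη_apply, abs_mul, abs_of_pos hε0]
    exact mul_le_mul_of_nonneg_left (abs_le.2 ⟨by linarith, by linarith⟩) hε0.le
  have hi : ∀ (s : Set E) (hs : MeasurableSet s), |η (indL hs)| ≤ φ i (indL hs) :=
    fun s hs => (hbound s hs).trans
      (mul_measureReal_inter_le_apply_indL (hnn i) hA hs fun x hx => hx.1)
  have hj : ∀ (s : Set E) (hs : MeasurableSet s), |η (indL hs)| ≤ φ j (indL hs) :=
    fun s hs => (hbound s hs).trans
      (mul_measureReal_inter_le_apply_indL (hnn j) hA hs fun x hx => hx.2)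
  have h0 : η (indL MeasurableSet.univ) = 0 := by
    rw [hη_apply, Set.inter_univ, Set.inter_univ]
    ring
  have hneg : ∀ g : Lp ℝ 2 μ, (-η) g = -(η g) := fun g => rfl
  have hplus := add_single_sub_single_mem_simplexFunctionals hφ.1 hi hj hij h0
  have hminus := add_single_sub_single_mem_simplexFunctionals (η := -η) hφ.1
    (fun s hs => by rw [hneg, abs_neg]; exact hi s hs)
    (fun s hs => by rw [hneg, abs_neg]; exact hj s hs) hij (by rw [hneg, h0, neg_zero])
  have heq := hφ.2 hplus hminus ⟨1 / 2, 1 / 2, by norm_num, by norm_num, by norm_num, by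
    rw [Pi.single_neg, Pi.single_neg]
    module⟩
  have hηi : η = 0 := by
    have := congrFun heq i
    simpa [hij] using this
  have hfinal := hη_apply B hB
  rw [hηi, Set.inter_self, hBC.symm.inter_eq, measureReal_empty, mul_zero, sub_zero] at hfinal
  have hzero : (0 : WeakDual ℝ (Lp ℝ 2 μ)) (indL hB) = 0 := rfl
  rw [hzero] at hfinal
  have : 0 < ε * (μ.real C * μ.real B) := by positivity
  exact this.ne hfinal

/-- An extreme point is given by the indicator functions of a measurable partition. -/
lemma exists_partition_of_mem_extremePoints [TopologicalSpace E]
    [SecondCountableTopology E] [T2Space E] [OpensMeasurableSpace E] [NullSingletonClass μ]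
    [LinearOrder ι] [Nonempty ι]
    {φ : ι → WeakDual ℝ (Lp ℝ 2 μ)} (hφ : φ ∈ (simplexFunctionals μ a).extremePoints ℝ) :
    ∃ Ω : ι → Set E, ∃ hΩ : ∀ i, MeasurableSet (Ω i),
      (∀ i j, i ≠ j → Ω i ∩ Ω j = ∅) ∧ ⋃ i, Ω i = Set.univ ∧
      (∀ i, μ.real (Ω i) = a i) ∧ ∀ i, φ i = ofLp (indL (hΩ i)) := by
  set f : ι → E → ℝ := fun i => rieszRep (φ i) with hf
  have hmeas : ∀ l, Measurable (f l) := fun l => (Lp.stronglyMeasurable _).measurable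
  obtain ⟨i₀⟩ := ‹Nonempty ι›
  let Ω : ι → Set E := fun i =>
    {x | (f i x ≠ 0 ∨ i = i₀ ∧ ∀ j, f j x = 0) ∧ ∀ j < i, f j x = 0}
  have hΩ : ∀ i, MeasurableSet (Ω i) := by
    intro i
    have hz : ∀ j, MeasurableSet {x | f j x = 0} := fun j => hmeas j (measurableSet_singleton 0)
    refine (((hz i).compl.union ((MeasurableSet.const _).inter ?_))).inter ?_
    · change MeasurableSet {x | ∀ j, f j x = 0}
      rw [Set.ofPred_forall]
      exact .iInter hz
    · change MeasurableSet {x | ∀ j < i, f j x = 0}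
      simp only [Set.ofPred_forall]
      exact .iInter fun j => .iInter fun _ => hz j
  have hlt : ∀ i j, i < j → ∀ x ∈ Ω i, x ∉ Ω j := by
    rintro i j hij x ⟨h1, -⟩ ⟨h3, h4⟩
    have hfi := h4 i hij
    rcases h1 with h1 | ⟨rfl, h1⟩
    · exact h1 hfi
    · rcases h3 with h3 | ⟨rfl, -⟩
      · exact h3 (h1 j)
      · exact lt_irrefl _ hij
  have hcover : ∀ x, ∃ i, x ∈ Ω i := by
    intro x
    by_cases hx : ∀ j, f j x = 0
    · exact ⟨i₀, Or.inr ⟨rfl, hx⟩, fun j _ => hx j⟩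
    · push Not at hx
      obtain ⟨i, hi⟩ := exists_minimal_of_wellFoundedLT (fun i => f i x ≠ 0) hx
      exact ⟨i, Or.inl hi.1, fun j hj => by_contra fun h => hi.not_prop_of_lt hj h⟩
  have hsum1 : ∀ᵐ x ∂μ, ∑ i, f i x = 1 := by
    have hint : Integrable (fun x => ∑ i, f i x) μ :=
      integrable_finsetSum _ fun i _ => integrable_rieszRep (φ i)
    refine hint.ae_eq_of_forall_setIntegral_eq _ _ (integrable_const 1) fun s hs _ => ?_
    rw [integral_finsetSum _ fun i _ => (integrable_rieszRep (φ i)).integrableOn]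
    have : ∀ i, ∫ x in s, f i x ∂μ = φ i (indL hs) := fun i => (apply_indL (φ i) hs).symm
    rw [Finset.sum_congr rfl fun i _ => this i, hφ.1.2.1 s hs]
    simp
  have hdisj : ∀ᵐ x ∂μ, ∀ i j, i ≠ j → f i x = 0 ∨ f j x = 0 := by
    refine ae_all_iff.2 fun i => ae_all_iff.2 fun j => ?_
    by_cases hij : i = j
    · simp [hij]
    · filter_upwards [ae_eq_zero_or_eq_zero_of_mem_extremePoints hφ hij] with x hx _ using hx
  have hind : ∀ i, φ i = ofLp (indL (hΩ i)) := by
    intro i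
    rw [← ofLp_rieszRep (φ i)]
    congr 1
    refine Lp.ext ?_
    filter_upwards [hsum1, hdisj, indL_coe (hΩ i)] with x h1 h2 h3
    rw [h3]
    change f i x = _
    by_cases hi : f i x = 0
    · rw [hi, Set.indicator_of_notMem]
      rintro ⟨h4 | ⟨-, h4⟩, -⟩
      · exact h4 hi
      · simp [h4] at h1
    · have hother : ∀ j, j ≠ i → f j x = 0 := fun j hj => (h2 j i hj).resolve_right hi
      rw [Set.indicator_of_mem (show x ∈ Ω i from ⟨Or.inl hi, fun j hj => hother j hj.ne⟩), ← h1]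
      exact (Fintype.sum_eq_single i hother).symm
  refine ⟨Ω, hΩ, fun i j hij => ?_, ?_, fun i => ?_, hind⟩
  · ext x
    refine iff_of_false (fun hx => ?_) (Set.notMem_empty x)
    rcases lt_or_gt_of_ne hij with h | h
    · exact hlt i j h x hx.1 hx.2
    · exact hlt j i h x hx.2 hx.1
  · exact Set.eq_univ_of_forall fun x => Set.mem_iUnion.2 (hcover x)
  · rw [← hφ.1.2.2 i, hind i, ofLp_indL_apply_indL, Set.inter_univ]

/-- Existence of a partition with prescribed measures maximizing the sum of the squared `L²` norms
of the images of the cells under a Markov operator. -/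
theorem exists_partition_isMax_sum_integral_sq [TopologicalSpace E]
    [SecondCountableTopology E] [T2Space E] [BorelSpace E] [NullSingletonClass μ]
    [LinearOrder ι] [Nonempty ι] (hk : IsMarkovDensity μ k) (ha : ∀ i, 0 ≤ a i)
    (hsum : ∑ i, a i = 1) :
    ∃ Ω : ι → Set E, (∀ i, MeasurableSet (Ω i)) ∧
      (∀ i j, i ≠ j → Ω i ∩ Ω j = ∅) ∧ ⋃ i, Ω i = Set.univ ∧ (∀ i, μ.real (Ω i) = a i) ∧
      ∀ Θ : ι → Set E, (∀ i, MeasurableSet (Θ i)) → (∀ i j, i ≠ j → Θ i ∩ Θ j = ∅) →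
        ⋃ i, Θ i = Set.univ → (∀ i, μ.real (Θ i) = a i) →
        ∑ i, ∫ y, (∫ z in Θ i, k y z ∂μ) ^ 2 ∂μ ≤ ∑ i, ∫ y, (∫ z in Ω i, k y z ∂μ) ^ 2 ∂μ := by
  obtain ⟨φ, hφ, hmax⟩ := exists_mem_extremePoints_isMaxOn hk ha hsum
  obtain ⟨Ω, hΩ, hd, hu, hm, hind⟩ := exists_partition_of_mem_extremePoints hφ
  refine ⟨Ω, hΩ, hd, hu, hm, fun Θ hΘ hΘd hΘu hΘm => ?_⟩
  have h : totalEnergy hk _ ≤ totalEnergy hk φ :=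
    hmax (ofLp_indL_mem_simplexFunctionals hΘ (fun i j => hΘd i j) hΘu hΘm)
  simpa only [totalEnergy, energy, hind, ofLp_indL_sectionLp] using h

end Partitions

/-- The quadratic form of the square of a symmetric Markov operator. -/
lemma setIntegral_setIntegral_integral_mul {μ : Measure E} [IsProbabilityMeasure μ]
    {k : E → E → ℝ} (hk : IsMarkovDensity μ k) (hsymm : ∀ y z, k y z = k z y) (s : Set E) :
    ∫ x in s, ∫ z in s, ∫ y, k x y * k y z ∂μ ∂μ ∂μ = ∫ y, (∫ z in s, k y z ∂μ) ^ 2 ∂μ := by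
  set G : E → ℝ := fun y => ∫ z in s, k y z ∂μ with hG
  have hGm : StronglyMeasurable G := hk.measurable.stronglyMeasurable.integral_prod_right
  have hG0 : ∀ y, 0 ≤ G y := fun y => integral_nonneg (hk.nonneg y)
  have hG1 : ∀ y, G y ≤ 1 := fun y => by
    rw [← hk.integral_eq_one y]
    exact setIntegral_le_integral (hk.integrable y) (.of_forall (hk.nonneg y))
  have hGnorm : ∀ y, ‖G y‖ ≤ 1 := fun y => by
    rw [Real.norm_of_nonneg (hG0 y)]
    exact hG1 y
  have hinner : ∀ x, ∫ z in s, ∫ y, k x y * k y z ∂μ ∂μ = ∫ y, k x y * G y ∂μ := by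
    intro x
    rw [integral_integral_swap]
    · simp_rw [integral_const_mul, hG]
    · refine (integrable_prod_iff' ?_).2 ⟨.of_forall fun y => ?_, ?_⟩
      · exact (((hk.measurable_section x).comp measurable_snd).mul
          (hk.measurable.comp measurable_swap)).aestronglyMeasurable
      · simp only [Function.uncurry_apply_pair]
        exact (hk.integrable y).integrableOn.const_mul _
      · have : ∀ y, ∫ z in s, ‖k x y * k y z‖ ∂μ = k x y * G y := by
          intro y
          simp_rw [Real.norm_of_nonneg (mul_nonneg (hk.nonneg x y) (hk.nonneg y _)),
            integral_const_mul, hG]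
        simp only [Function.uncurry_apply_pair, this]
        exact (hk.integrable x).mul_bdd (c := 1) hGm.aestronglyMeasurable (.of_forall hGnorm)
  simp_rw [hinner]
  rw [integral_integral_swap]
  · refine integral_congr_ae (.of_forall fun y => ?_)
    simp only [integral_mul_const, hsymm _ y, hG, sq]
  · refine (integrable_prod_iff' ?_).2 ⟨.of_forall fun y => ?_, ?_⟩
    · exact (hk.measurable.mul (hGm.measurable.comp measurable_snd)).aestronglyMeasurable
    · simp only [Function.uncurry_apply_pair, hsymm _ y]
      exact (hk.integrable y).integrableOn.mul_const _
    · have : ∀ y, ∫ x in s, ‖k x y * G y‖ ∂μ = G y ^ 2 := by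
        intro y
        simp_rw [Real.norm_of_nonneg (mul_nonneg (hk.nonneg _ y) (hG0 y)),
          integral_mul_const, hsymm _ y, hG, sq]
      simp only [Function.uncurry_apply_pair, this]
      refine Integrable.of_bound (hGm.pow 2).aestronglyMeasurable 1 (.of_forall fun y => ?_)
      rw [norm_pow]
      exact pow_le_one₀ (norm_nonneg _) (hGnorm y)

end NoiseStability

lemma nullSingletonClass_gaussianMeasure (n : ℕ) :
    NullSingletonClass (gaussianMeasure (n + 1)) :=
  ⟨fun x => withDensity_absolutelyContinuous _ _ (measure_singleton x)⟩

lemma isMarkovDensity_mehlerKernel (d : ℕ) {r : ℝ} (hr : r ^ 2 < 1) :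
    IsMarkovDensity (gaussianMeasure d) (mehlerKernel d r) where
  measurable := (continuous_mehlerKernel d r).measurable
  nonneg := mehlerKernel_nonneg d hr
  bounded y := ⟨_, mehlerKernel_le d hr y⟩
  integral_eq_one := integral_mehlerKernel d hr

/-- The noise stability of a set is the squared `L²` norm of the image of its indicator function
under the square root of the Ornstein-Uhlenbeck operator. -/
lemma integral_indicator_mul_ouOp_indicator (d : ℕ) {r : ℝ} (hr : r ^ 2 < 1)
    {s : Set (EuclideanSpace ℝ (Fin d))} (hs : MeasurableSet s) :
    ∫ x, s.indicator (fun _ => (1 : ℝ)) x * ouOp d (r ^ 2) (s.indicator fun _ => (1 : ℝ)) x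
        ∂gaussianMeasure d
      = ∫ y, (∫ z in s, mehlerKernel d r y z ∂gaussianMeasure d) ^ 2 ∂gaussianMeasure d := by
  have := isProbabilityMeasure_gaussianMeasure d
  have hr2 : (r ^ 2) ^ 2 < 1 := pow_lt_one₀ (sq_nonneg r) hr two_ne_zero
  have hmul : ∀ (g : EuclideanSpace ℝ (Fin d) → ℝ) x,
      s.indicator (fun _ => (1 : ℝ)) x * g x = s.indicator g x := by
    intro g x
    by_cases hx : x ∈ s <;> simp [hx]
  rw [← setIntegral_setIntegral_integral_mul (isMarkovDensity_mehlerKernel d hr)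
    (mehlerKernel_comm d r) s]
  simp_rw [hmul, integral_mehlerKernel_mul_mehlerKernel d hr]
  rw [integral_indicator hs]
  refine integral_congr_ae (.of_forall fun x => ?_)
  simp only [ouOp_eq_integral_mehlerKernel d hr2, hmul, integral_indicator hs]

/-- existence of a Gaussian-measure-constrained partition maximizing
total noise stability. -/
theorem exists_max_noise_stable_partition (n m : ℕ) (hm : 2 ≤ m)
    (ρ : ℝ) (hρ : ρ ∈ Set.Ioo (0 : ℝ) 1)
    (a : Fin m → ℝ) (ha : ∀ i, 0 < a i) (hsum : ∑ i, a i = 1) :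
    ∃ Ω : Fin m → Set (EuclideanSpace ℝ (Fin (n + 1))),
      (∀ i, MeasurableSet (Ω i)) ∧
      (∀ i j, i ≠ j → Ω i ∩ Ω j = ∅) ∧
      (⋃ i, Ω i) = Set.univ ∧
      (∀ i, gaussianMeasure (n + 1) (Ω i) = ENNReal.ofReal (a i)) ∧
      (∀ Θ : Fin m → Set (EuclideanSpace ℝ (Fin (n + 1))),
        (∀ i, MeasurableSet (Θ i)) →
        (∀ i j, i ≠ j → Θ i ∩ Θ j = ∅) →
        (⋃ i, Θ i) = Set.univ →
        (∀ i, gaussianMeasure (n + 1) (Θ i) = ENNReal.ofReal (a i)) →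
        ∑ i, ∫ x, Set.indicator (Θ i) (fun _ => (1 : ℝ)) x
            * ouOp (n + 1) ρ (Set.indicator (Θ i) (fun _ => (1 : ℝ))) x
            ∂(gaussianMeasure (n + 1))
          ≤ ∑ i, ∫ x, Set.indicator (Ω i) (fun _ => (1 : ℝ)) x
            * ouOp (n + 1) ρ (Set.indicator (Ω i) (fun _ => (1 : ℝ))) x
            ∂(gaussianMeasure (n + 1))) := by
  have hρ' : √ρ ^ 2 = ρ := Real.sq_sqrt hρ.1.le
  have hr : √ρ ^ 2 < 1 := hρ'.trans_lt hρ.2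
  have := isProbabilityMeasure_gaussianMeasure (n + 1)
  have := nullSingletonClass_gaussianMeasure n
  have : Nonempty (Fin m) := ⟨⟨0, by omega⟩⟩
  have hreal : ∀ (s : Set (EuclideanSpace ℝ (Fin (n + 1)))) (i : Fin m),
      (gaussianMeasure (n + 1)).real s = a i ↔
        gaussianMeasure (n + 1) s = ENNReal.ofReal (a i) := by
    intro s i
    rw [measureReal_def, ← ENNReal.toReal_eq_toReal_iff' (measure_ne_top _ s)
      ENNReal.ofReal_ne_top, ENNReal.toReal_ofReal (ha i).le]
  obtain ⟨Ω, hΩ, hd, hu, hm', hmax⟩ := exists_partition_isMax_sum_integral_sq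
    (isMarkovDensity_mehlerKernel (n + 1) hr) (fun i => (ha i).le) hsum
  refine ⟨Ω, hΩ, hd, hu, fun i => (hreal _ i).1 (hm' i), fun Θ hΘ hΘd hΘu hΘm => ?_⟩
  have h := hmax Θ hΘ hΘd hΘu fun i => (hreal _ i).2 (hΘm i)
  simpa only [← integral_indicator_mul_ouOp_indicator (n + 1) hr (hΘ _),
    ← integral_indicator_mul_ouOp_indicator (n + 1) hr (hΩ _), hρ'] using h
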